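/- Let μ be a real number with μ ≥ −1, assume p + m/n > 1, and set f(ζ) = ζ^{p + m/n} (log(e + 1/ζ))^μ for ζ > 0 and f(0) = 0. Then every global weak solution u of u_t − Σ_{|α|=m} ∂^α a_α(x,t,u) ≥ f(|u|) in ℝ^{n+1}_+ with u(·,0) = u_0 ≥ 0 is trivial, i.e. u = 0 almost everywhere in ℝ^{n+1}_+. -/

import Mathlib

open MeasureTheory Real Set Filter

noncomputable section

/-- The spatial domain `ℝⁿ`. -/
abbrev Spc (n : ℕ) := EuclideanSpace ℝ (Fin n)

/-- The open ball `B_r` in `ℝⁿ` of radius `r` centered at `0`. -/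
def ball0 (n : ℕ) (r : ℝ) : Set (Spc n) := Metric.ball 0 r

/-- The cylinder `Q_r^κ = B_r × (0, r^κ)`. -/
def cyl (n : ℕ) (r κ : ℝ) : Set (Spc n × ℝ) := ball0 n r ×ˢ Ioo 0 (r ^ κ)

/-- The half-space `ℝ^{n+1}_+ = ℝⁿ × (0, ∞)`. -/
def halfSp (n : ℕ) : Set (Spc n × ℝ) := {z | 0 < z.2}

/-- The (finite) set of multi-indices `α` with `|α| = m`. -/
def mIdx (n m : ℕ) : Finset (Fin n → ℕ) :=
  (Fintype.piFinset fun _ : Fin n => Finset.range (m + 1)).filter fun α => ∑ i, α i = m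

/-- Spatial partial derivative `∂/∂x_i`. -/
def spDeriv (n : ℕ) (i : Fin n) (φ : Spc n × ℝ → ℝ) : Spc n × ℝ → ℝ :=
  fun z => deriv (fun s : ℝ => φ (z.1 + s • EuclideanSpace.single i (1 : ℝ), z.2)) 0

/-- Time derivative `∂/∂t`. -/
def tDeriv (n : ℕ) (φ : Spc n × ℝ → ℝ) : Spc n × ℝ → ℝ :=
  fun z => deriv (fun s : ℝ => φ (z.1, s)) z.2

/-- Multi-index spatial derivative `∂^α`. -/
def mDeriv (n : ℕ) (α : Fin n → ℕ) (φ : Spc n × ℝ → ℝ) : Spc n × ℝ → ℝ :=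
  (List.finRange n).foldr (fun i ψ => (spDeriv n i)^[α i] ψ) φ

/-- Caratheodory conditions and the growth bound `|a_α(x,t,ζ)| ≤ A |ζ|^p` for the
coefficients of the operator `L`. -/
def GoodCoeffs (n m : ℕ) (A p : ℝ) (a : (Fin n → ℕ) → Spc n × ℝ → ℝ → ℝ) : Prop :=
  ∀ α ∈ mIdx n m,
    (∀ ζ : ℝ, Measurable fun z => a α z ζ) ∧
    (∀ᵐ z ∂(volume.restrict (halfSp n)), Continuous fun ζ => a α z ζ) ∧
    (∀ᵐ z ∂(volume.restrict (halfSp n)), ∀ ζ : ℝ, |a α z ζ| ≤ A * |ζ| ^ p)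

/-- The standing conditions on `f`: `ζ ↦ f ζ` and `ζ ↦ f (ζ^{1/p})` are nondecreasing
and convex on `[0,∞)`, and `f` is positive on `(0,∞)`. -/
def GoodF (p : ℝ) (f : ℝ → ℝ) : Prop :=
  MonotoneOn f (Ici 0) ∧ ConvexOn ℝ (Ici 0) f ∧
  MonotoneOn (fun ζ => f (ζ ^ (1 / p))) (Ici 0) ∧
  ConvexOn ℝ (Ici 0) (fun ζ => f (ζ ^ (1 / p))) ∧
  ∀ ζ : ℝ, 0 < ζ → 0 < f ζ

/-- Condition (1.4): `∫_1^∞ ζ^{1/k - 1} f(ζ)^{-1/k} dζ < ∞`. -/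
def Cond14 (k : ℕ) (f : ℝ → ℝ) : Prop :=
  IntegrableOn (fun ζ : ℝ => ζ ^ ((k : ℝ)⁻¹ - 1) / f ζ ^ ((k : ℝ)⁻¹)) (Ioi 1)

/-- Condition (1.5): `∫_1^∞ ζ^{p/m - 1} f(ζ)^{-1/m} dζ < ∞`. -/
def Cond15 (m : ℕ) (p : ℝ) (f : ℝ → ℝ) : Prop :=
  IntegrableOn (fun ζ : ℝ => ζ ^ (p / (m : ℝ) - 1) / f ζ ^ ((m : ℝ)⁻¹)) (Ioi 1)

/-- `v ∈ L^1_loc(ℝⁿ)`. -/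
def L1locInit (n : ℕ) (v : Spc n → ℝ) : Prop :=
  ∀ r : ℝ, 0 < r → IntegrableOn v (ball0 n r)

/-- `u` is a global weak solution of
`∂_t^k u - Σ_{|α| = m} ∂^α a_α(x,t,u) ≥ f(|u|)` in `ℝ^{n+1}_+`, with initial data
`∂_t^i u(·,0) = u0 i` for `0 ≤ i ≤ k-1`. -/
def IsGlobalWeakSol (n k m : ℕ) (p : ℝ) (a : (Fin n → ℕ) → Spc n × ℝ → ℝ → ℝ)
    (f : ℝ → ℝ) (u0 : ℕ → Spc n → ℝ) (u : Spc n × ℝ → ℝ) : Prop :=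
  (∀ r : ℝ, 0 < r → IntegrableOn u (cyl n r 1)) ∧
  (∀ r : ℝ, 0 < r → IntegrableOn (fun z => |u z| ^ p) (cyl n r 1)) ∧
  (∀ r : ℝ, 0 < r → IntegrableOn (fun z => f |u z|) (cyl n r 1)) ∧
  ∀ φ : Spc n × ℝ → ℝ, ContDiff ℝ (⊤ : ℕ∞) φ → HasCompactSupport φ →
    (∀ z, 0 ≤ φ z) →
    (∫ z in halfSp n, (-1 : ℝ) ^ k * u z * (tDeriv n)^[k] φ z)
      - (∫ z in halfSp n, ∑ α ∈ mIdx n m, (-1 : ℝ) ^ m * a α z (u z) * mDeriv n α φ z)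
    ≥ (∫ x : Spc n, ∑ i ∈ Finset.range k,
          (-1 : ℝ) ^ i * u0 (k - 1 - i) x * (tDeriv n)^[i] φ (x, 0))
      + ∫ z in halfSp n, f |u z| * φ z

/-- `u = 0` almost everywhere in `ℝ^{n+1}_+`. -/
def TrivialSol (n : ℕ) (u : Spc n × ℝ → ℝ) : Prop :=
  ∀ᵐ z ∂(volume.restrict (halfSp n)), u z = 0

/-- The anisotropic dilation `(x, t) ↦ (c x, d t)`. -/
def dilate (n : ℕ) (c d : ℝ) (z : Spc n × ℝ) : Spc n × ℝ := (c • z.1, d * z.2)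

lemma spDeriv_comp_dilate (n : ℕ) (i : Fin n) (b c d : ℝ) (ψ : Spc n × ℝ → ℝ) :
    spDeriv n i (fun z => b * ψ (dilate n c d z)) =
      fun z => (c * b) * spDeriv n i ψ (dilate n c d z) := by
  funext z
  have h := deriv_comp_mul_left c
    (fun s : ℝ => ψ (c • z.1 + s • EuclideanSpace.single i (1 : ℝ), d * z.2)) 0
  simp only [spDeriv, dilate, deriv_const_mul_field, smul_add, smul_smul] at h ⊢
  rw [h]
  simp only [mul_zero, smul_eq_mul]
  ring

lemma iterate_spDeriv_comp_dilate (n : ℕ) (i : Fin n) (b c d : ℝ) (ψ : Spc n × ℝ → ℝ) (k : ℕ) :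
    (spDeriv n i)^[k] (fun z => b * ψ (dilate n c d z)) =
      fun z => (c ^ k * b) * (spDeriv n i)^[k] ψ (dilate n c d z) := by
  induction k with
  | zero => simp
  | succ k ih =>
    rw [Function.iterate_succ_apply', ih, spDeriv_comp_dilate, Function.iterate_succ_apply']
    funext z
    ring

lemma mDeriv_comp_dilate (n : ℕ) (α : Fin n → ℕ) (c d : ℝ) (ψ : Spc n × ℝ → ℝ) :
    mDeriv n α (fun z => ψ (dilate n c d z)) =
      fun z => c ^ (∑ i, α i) * mDeriv n α ψ (dilate n c d z) := by
  have key : ∀ l : List (Fin n),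
      l.foldr (fun i χ => (spDeriv n i)^[α i] χ) (fun z => ψ (dilate n c d z)) =
        fun z => c ^ (l.map α).sum *
          l.foldr (fun i χ => (spDeriv n i)^[α i] χ) ψ (dilate n c d z) := by
    intro l
    induction l with
    | nil => simp
    | cons i l ih =>
      rw [List.foldr_cons, ih, iterate_spDeriv_comp_dilate]
      funext z
      simp [pow_add]
  rw [mDeriv, key, Fin.sum_univ_def]
  rfl

lemma tDeriv_comp_dilate (n : ℕ) (c d : ℝ) (ψ : Spc n × ℝ → ℝ) :
    tDeriv n (fun z => ψ (dilate n c d z)) = fun z => d * tDeriv n ψ (dilate n c d z) := by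
  funext z
  simpa [tDeriv, dilate] using deriv_comp_mul_left d (fun s : ℝ => ψ (c • z.1, s)) z.2

lemma spDeriv_eq_fderiv {n : ℕ} {φ : Spc n × ℝ → ℝ} (hφ : Differentiable ℝ φ) (i : Fin n)
    (z : Spc n × ℝ) :
    spDeriv n i φ z = fderiv ℝ φ z (EuclideanSpace.single i (1 : ℝ), 0) := by
  have h1 : HasDerivAt
      (fun s : ℝ => (z.1 + s • EuclideanSpace.single i (1 : ℝ), z.2) : ℝ → Spc n × ℝ)
      (EuclideanSpace.single i (1 : ℝ), 0) 0 := by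
    refine HasDerivAt.prodMk ?_ (hasDerivAt_const _ _)
    simpa using ((hasDerivAt_id (0 : ℝ)).smul_const
      (EuclideanSpace.single i (1 : ℝ) : Spc n)).const_add z.1
  have h2 : HasFDerivAt φ (fderiv ℝ φ z)
      ((z.1 + (0 : ℝ) • EuclideanSpace.single i (1 : ℝ), z.2) : Spc n × ℝ) := by
    simpa using (hφ z).hasFDerivAt
  exact (h2.comp_hasDerivAt (0 : ℝ) h1).deriv

lemma tDeriv_eq_fderiv {n : ℕ} {φ : Spc n × ℝ → ℝ} (hφ : Differentiable ℝ φ)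
    (z : Spc n × ℝ) : tDeriv n φ z = fderiv ℝ φ z (0, 1) := by
  have h1 : HasDerivAt (fun s : ℝ => (z.1, s) : ℝ → Spc n × ℝ) (0, 1) z.2 :=
    (hasDerivAt_const _ _).prodMk (hasDerivAt_id _)
  exact ((hφ z).hasFDerivAt.comp_hasDerivAt z.2 h1).deriv

/-- `ψ` is divisible by `G ^ j` with smooth quotient. -/
def PowFactor (n : ℕ) (G : Spc n × ℝ → ℝ) (j : ℕ) (ψ : Spc n × ℝ → ℝ) : Prop :=
  ∃ H : Spc n × ℝ → ℝ, ContDiff ℝ (⊤ : ℕ∞) H ∧ ψ = fun z => G z ^ j * H z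

lemma PowFactor.contDiff {n : ℕ} {G ψ : Spc n × ℝ → ℝ} {j : ℕ} (hG : ContDiff ℝ (⊤ : ℕ∞) G)
    (h : PowFactor n G j ψ) : ContDiff ℝ (⊤ : ℕ∞) ψ := by
  obtain ⟨H, hH, rfl⟩ := h
  exact (hG.pow j).mul hH

lemma PowFactor.fderiv_apply {n : ℕ} {G ψ : Spc n × ℝ → ℝ} {j : ℕ} (hG : ContDiff ℝ (⊤ : ℕ∞) G)
    (h : PowFactor n G (j + 1) ψ) (v : Spc n × ℝ) :
    PowFactor n G j (fun z => fderiv ℝ ψ z v) := by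
  obtain ⟨H, hH, rfl⟩ := h
  have hdG := hG.fderiv_right (m := (⊤ : ℕ∞)) (by simp)
  have hdH := hH.fderiv_right (m := (⊤ : ℕ∞)) (by simp)
  refine ⟨fun z => ((j : ℝ) + 1) * fderiv ℝ G z v * H z + G z * fderiv ℝ H z v, ?_, ?_⟩
  · exact ((contDiff_const.mul (hdG.clm_apply contDiff_const)).mul hH).add
      (hG.mul (hdH.clm_apply contDiff_const))
  · funext z
    have hGz : HasFDerivAt G (fderiv ℝ G z) z :=
      (hG.differentiable (by simp) z).hasFDerivAt
    have hHz : HasFDerivAt H (fderiv ℝ H z) z :=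
      (hH.differentiable (by simp) z).hasFDerivAt
    have hprod : HasFDerivAt (fun z => G z ^ (j + 1) * H z) _ z := (hGz.pow (j + 1)).mul hHz
    rw [hprod.fderiv]
    simp
    ring

lemma PowFactor.spDeriv_right {n : ℕ} {G ψ : Spc n × ℝ → ℝ} {j : ℕ} (hG : ContDiff ℝ (⊤ : ℕ∞) G)
    (h : PowFactor n G (j + 1) ψ) (i : Fin n) : PowFactor n G j (spDeriv n i ψ) := by
  have hd := (h.contDiff hG).differentiable (by simp)
  rw [show spDeriv n i ψ = _ from funext (spDeriv_eq_fderiv hd i)]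
  exact h.fderiv_apply hG _

lemma PowFactor.iterate_spDeriv_right {n : ℕ} {G ψ : Spc n × ℝ → ℝ} {j : ℕ}
    (hG : ContDiff ℝ (⊤ : ℕ∞) G) (i : Fin n) (k : ℕ) (h : PowFactor n G (j + k) ψ) :
    PowFactor n G j ((spDeriv n i)^[k] ψ) := by
  induction k generalizing ψ with
  | zero => simpa using h
  | succ k ih => exact ih (h.spDeriv_right hG i)

lemma PowFactor.mDeriv_right {n : ℕ} {G ψ : Spc n × ℝ → ℝ} {j : ℕ}
    (hG : ContDiff ℝ (⊤ : ℕ∞) G) (α : Fin n → ℕ) (h : PowFactor n G (j + ∑ i, α i) ψ) :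
    PowFactor n G j (mDeriv n α ψ) := by
  have key : ∀ (l : List (Fin n)) (j : ℕ), PowFactor n G (j + (l.map α).sum) ψ →
      PowFactor n G j (l.foldr (fun i χ => (spDeriv n i)^[α i] χ) ψ) := by
    intro l
    induction l with
    | nil => intro j hj; simpa using hj
    | cons i l ih =>
      intro j hj
      rw [List.foldr_cons]
      refine PowFactor.iterate_spDeriv_right hG i _ (ih _ ?_)
      simpa [add_assoc] using hj
  refine key _ j ?_
  rwa [Fin.sum_univ_def] at h

lemma PowFactor.exists_bound {n : ℕ} {G ψ : Spc n × ℝ → ℝ} {j : ℕ} (hj : j ≠ 0)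
    (hG0 : ∀ z, 0 ≤ G z) (hG : HasCompactSupport G) (h : PowFactor n G j ψ) :
    ∃ C : ℝ, 0 ≤ C ∧ ∀ z, |ψ z| ≤ C * G z ^ j := by
  obtain ⟨H, hH, rfl⟩ := h
  obtain ⟨C, hC⟩ := IsCompact.exists_bound_of_continuousOn hG hH.continuous.continuousOn
  refine ⟨|C|, abs_nonneg _, fun z => ?_⟩
  by_cases hz : z ∈ tsupport G
  · rw [abs_mul, abs_of_nonneg (pow_nonneg (hG0 z) j), mul_comm]
    exact mul_le_mul_of_nonneg_right ((hC z hz).trans (le_abs_self C)) (pow_nonneg (hG0 z) j)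
  · simp [image_eq_zero_of_notMem_tsupport hz, hj]

lemma spDeriv_eq_zero_of_eqOn {n : ℕ} {ψ : Spc n × ℝ → ℝ} {b : ℝ} {U : Set (Spc n × ℝ)}
    (hU : IsOpen U) (h : ∀ z ∈ U, ψ z = b) (i : Fin n) : ∀ z ∈ U, spDeriv n i ψ z = 0 := by
  intro z hz
  have hc : Continuous
      (fun s : ℝ => (z.1 + s • EuclideanSpace.single i (1 : ℝ), z.2) : ℝ → Spc n × ℝ) := by
    fun_prop
  have : (fun s : ℝ => ψ (z.1 + s • EuclideanSpace.single i (1 : ℝ), z.2)) =ᶠ[nhds 0]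
      fun _ => b := by
    filter_upwards [hc.continuousAt.preimage_mem_nhds (hU.mem_nhds (by simpa using hz))]
      with s hs using h _ hs
  simp [spDeriv, this.deriv_eq]

lemma tDeriv_eq_zero_of_eqOn {n : ℕ} {ψ : Spc n × ℝ → ℝ} {b : ℝ} {U : Set (Spc n × ℝ)}
    (hU : IsOpen U) (h : ∀ z ∈ U, ψ z = b) : ∀ z ∈ U, tDeriv n ψ z = 0 := by
  intro z hz
  have hc : Continuous (fun s : ℝ => (z.1, s) : ℝ → Spc n × ℝ) := by fun_prop
  have : (fun s : ℝ => ψ (z.1, s)) =ᶠ[nhds z.2] fun _ => b := by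
    filter_upwards [hc.continuousAt.preimage_mem_nhds (hU.mem_nhds (by simpa using hz))]
      with s hs using h _ hs
  simp [tDeriv, this.deriv_eq]

lemma mDeriv_eq_zero_of_eqOn {n : ℕ} {ψ : Spc n × ℝ → ℝ} {b : ℝ} {U : Set (Spc n × ℝ)}
    (hU : IsOpen U) (h : ∀ z ∈ U, ψ z = b) (α : Fin n → ℕ) (hα : ∑ i, α i ≠ 0) :
    ∀ z ∈ U, mDeriv n α ψ z = 0 := by
  have iter : ∀ (i : Fin n) (k : ℕ) (χ : Spc n × ℝ → ℝ) (b : ℝ), (∀ z ∈ U, χ z = b) →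
      ∃ b', (b = 0 ∨ k ≠ 0 → b' = 0) ∧ ∀ z ∈ U, (spDeriv n i)^[k] χ z = b' := by
    intro i k
    induction k with
    | zero => intro χ b hχ; exact ⟨b, by simp, hχ⟩
    | succ k ih =>
      intro χ b hχ
      obtain ⟨b', hb', h'⟩ := ih (spDeriv n i χ) 0 (spDeriv_eq_zero_of_eqOn hU hχ i)
      exact ⟨b', fun _ => hb' (Or.inl rfl), h'⟩
  have key : ∀ l : List (Fin n), ∃ b', ((l.map α).sum ≠ 0 → b' = 0) ∧
      ∀ z ∈ U, l.foldr (fun i χ => (spDeriv n i)^[α i] χ) ψ z = b' := by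
    intro l
    induction l with
    | nil => exact ⟨b, by simp, h⟩
    | cons i l ih =>
      obtain ⟨b', hb', h'⟩ := ih
      obtain ⟨b'', hb'', h''⟩ := iter i (α i) _ b' h'
      refine ⟨b'', fun hs => hb'' ?_, h''⟩
      by_cases h0 : α i = 0
      · exact Or.inl (hb' (by simpa [h0] using hs))
      · exact Or.inr h0
  obtain ⟨b', hb', h'⟩ := key (List.finRange n)
  rw [Fin.sum_univ_def] at hα
  rw [hb' hα] at h'
  exact h'

/-- A cutoff function whose `N`-th power has derivatives controlled by `G ^ (N - m)`. -/
lemma exists_cutoff (n m N : ℕ) (hm : 1 ≤ m) (hN : m < N) :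
    ∃ (G : Spc n × ℝ → ℝ) (C : ℝ), 0 ≤ C ∧ ContDiff ℝ (⊤ : ℕ∞) G ∧
      (∀ z, 0 ≤ G z) ∧ (∀ z, G z ≤ 1) ∧ (∀ z, ‖z‖ < 1 → G z = 1) ∧ (∀ z, 2 ≤ ‖z‖ → G z = 0) ∧
      (∀ z, |tDeriv n (fun z => G z ^ N) z| ≤ C * G z ^ (N - m)) ∧
      (∀ z, ‖z‖ < 1 → tDeriv n (fun z => G z ^ N) z = 0) ∧
      ∀ α ∈ mIdx n m, (∀ z, |mDeriv n α (fun z => G z ^ N) z| ≤ C * G z ^ (N - m)) ∧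
        ∀ z, ‖z‖ < 1 → mDeriv n α (fun z => G z ^ N) z = 0 := by
  let B : ContDiffBump (0 : Spc n × ℝ) := ⟨1, 2, one_pos, one_lt_two⟩
  have hGs : ContDiff ℝ (⊤ : ℕ∞) B := B.contDiff
  have h1 : ∀ z, ‖z‖ < 1 → B z = 1 := fun z hz =>
    B.one_of_mem_closedBall (by simpa [B] using hz.le)
  have hU : ∀ z ∈ Metric.ball (0 : Spc n × ℝ) 1, B z ^ N = 1 := fun z hz => by
    rw [h1 z (by simpa using hz), one_pow]
  have hpow : ∀ j, PowFactor n B j (fun z => B z ^ j) := fun j =>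
    ⟨fun _ => 1, contDiff_const, by simp⟩
  have hNm : N - m ≠ 0 := by omega
  have ht : PowFactor n B (N - m) (tDeriv n (fun z => B z ^ N)) := by
    have hd := ((hpow N).contDiff hGs).differentiable (by simp)
    rw [show tDeriv n (fun z => B z ^ N) = _ from funext (tDeriv_eq_fderiv hd)]
    refine PowFactor.fderiv_apply hGs ⟨fun z => B z ^ (m - 1), hGs.pow _, ?_⟩ _
    funext z
    rw [← pow_add]
    congr 1
    omega
  obtain ⟨C₀, hC₀, hb₀⟩ := ht.exists_bound hNm (fun z => B.nonneg) B.hasCompactSupport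
  have hα : ∀ α ∈ mIdx n m, ∃ C : ℝ, 0 ≤ C ∧
      ∀ z, |mDeriv n α (fun z => B z ^ N) z| ≤ C * B z ^ (N - m) := by
    intro α hα
    have hs : ∑ i, α i = m := (Finset.mem_filter.1 hα).2
    refine PowFactor.exists_bound hNm (fun z => B.nonneg) B.hasCompactSupport
      (PowFactor.mDeriv_right hGs α ?_)
    rw [hs, Nat.sub_add_cancel hN.le]
    exact hpow N
  choose! C₁ hC₁ hb₁ using hα
  have hsum : 0 ≤ ∑ α ∈ mIdx n m, C₁ α := Finset.sum_nonneg hC₁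
  refine ⟨B, C₀ + ∑ α ∈ mIdx n m, C₁ α, by positivity, hGs, fun z => B.nonneg,
    fun z => B.le_one, h1, fun z hz => B.zero_of_le_dist (by simpa [B] using hz), ?_, ?_, ?_⟩
  · intro z
    have := pow_nonneg (B.nonneg (x := z)) (N - m)
    exact (hb₀ z).trans (mul_le_mul_of_nonneg_right (by linarith) this)
  · exact fun z hz => tDeriv_eq_zero_of_eqOn Metric.isOpen_ball hU z (by simpa using hz)
  · intro α hα
    refine ⟨fun z => ?_, fun z hz => mDeriv_eq_zero_of_eqOn Metric.isOpen_ball hU α ?_ z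
      (by simpa using hz)⟩
    · have := pow_nonneg (B.nonneg (x := z)) (N - m)
      have h2 := Finset.single_le_sum hC₁ hα
      exact (hb₁ α hα z).trans (mul_le_mul_of_nonneg_right (by linarith) this)
    · rw [(Finset.mem_filter.1 hα).2]
      omega

lemma rpow_le_linear {w l θ : ℝ} (hw : 0 ≤ w) (hl : 0 < l) (hθ : 0 < θ) (hθ1 : θ < 1) :
    w ^ θ ≤ l ^ (θ - 1) * w + l ^ θ := by
  rcases le_total w l with h | h
  · have h1 := rpow_le_rpow hw h hθ.le
    have h2 : 0 ≤ l ^ (θ - 1) * w := by positivity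
    linarith
  · have hw' : 0 < w := hl.trans_le h
    have h1 : w ^ (θ - 1) ≤ l ^ (θ - 1) := rpow_le_rpow_of_nonpos hl h (by linarith)
    have h2 : w ^ θ = w ^ (θ - 1) * w := by
      rw [← rpow_add_one hw'.ne', sub_add_cancel]
    have h3 : 0 ≤ l ^ θ := by positivity
    rw [h2]
    nlinarith

lemma abs_integral_le_of_rpow_bound {X : Type*} [MeasurableSpace X] {ν : Measure X}
    {H D : Set X} (hD : MeasurableSet D) (hDH : D ⊆ H) {V : ℝ} (hV : 0 < V)
    (hDV : ν D ≤ ENNReal.ofReal V) {w g : X → ℝ} (hw : IntegrableOn w D ν)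
    (hw0 : ∀ z, 0 ≤ w z) {Y : ℝ} (hY : 0 < Y) (hXY : ∫ z in D, w z ∂ν ≤ Y)
    {θ M e L : ℝ} (hθ : 0 < θ) (hθ1 : θ < 1) (hM : 0 ≤ M) (he : 0 ≤ e) (hL : 0 ≤ L)
    (hg : ∀ᵐ z ∂ν.restrict H, |g z| ≤ D.indicator (fun z => M * (e + L ^ θ * w z ^ θ)) z) :
    |∫ z in H, g z ∂ν| ≤ M * (e * V + 2 * ((L * Y) ^ θ * V ^ (1 - θ))) := by
  set l := Y / V with hl
  have hl0 : 0 < l := by positivity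
  have hfin : ν D < ⊤ := hDV.trans_lt ENNReal.ofReal_lt_top
  set B : X → ℝ := fun z => M * (e + L ^ θ * l ^ θ) + M * L ^ θ * l ^ (θ - 1) * w z with hB
  have hBint : IntegrableOn B D ν :=
    (integrableOn_const hfin.ne).add (hw.const_mul _)
  have hDr : ν.real D ≤ V := ENNReal.toReal_le_of_le_ofReal hV.le hDV
  have hind : Integrable (D.indicator B) (ν.restrict H) := by
    rw [integrable_indicator_iff hD, IntegrableOn, Measure.restrict_restrict hD,
      inter_eq_left.2 hDH]
    exact hBint
  have hbound : ∀ᵐ z ∂ν.restrict H, ‖g z‖ ≤ D.indicator B z := by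
    filter_upwards [hg] with z hz
    rw [norm_eq_abs]
    refine hz.trans (indicator_le_indicator ?_)
    have h1 := rpow_le_linear (hw0 z) hl0 hθ hθ1
    have h2 : 0 ≤ M * L ^ θ := by positivity
    have h3 := mul_le_mul_of_nonneg_left h1 h2
    simp only [hB]
    nlinarith
  have h1 := norm_integral_le_of_norm_le hind hbound
  rw [norm_eq_abs, integral_indicator hD, Measure.restrict_restrict hD,
    inter_eq_left.2 hDH] at h1
  refine h1.trans ?_
  have h3 : ∫ z in D, B z ∂ν = ν.real D * (M * (e + L ^ θ * l ^ θ)) +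
      M * L ^ θ * l ^ (θ - 1) * ∫ z in D, w z ∂ν := by
    have hconst : IntegrableOn (fun _ => M * (e + L ^ θ * l ^ θ)) D ν :=
      integrableOn_const hfin.ne
    rw [hB, integral_add hconst (hw.const_mul _), setIntegral_const, smul_eq_mul,
      integral_const_mul]
  have h4 : ν.real D * (M * (e + L ^ θ * l ^ θ)) ≤ V * (M * (e + L ^ θ * l ^ θ)) :=
    mul_le_mul_of_nonneg_right hDr (by positivity)
  have h5 : M * L ^ θ * l ^ (θ - 1) * ∫ z in D, w z ∂ν ≤ M * L ^ θ * l ^ (θ - 1) * Y :=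
    mul_le_mul_of_nonneg_left hXY (by positivity)
  have h6 : l ^ θ * V = Y ^ θ * V ^ (1 - θ) := by
    rw [hl, div_rpow hY.le hV.le, rpow_sub hV, rpow_one]
    ring
  have h7 : l ^ (θ - 1) * Y = l ^ θ * V := by
    rw [rpow_sub hl0, rpow_one, hl]
    field_simp
  have h8 : (L * Y) ^ θ = L ^ θ * Y ^ θ := mul_rpow hL hY.le
  have h9 : V * (M * (e + L ^ θ * l ^ θ)) + M * L ^ θ * l ^ (θ - 1) * Y =
      M * (e * V + 2 * ((L * Y) ^ θ * V ^ (1 - θ))) := by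
    rw [h8]
    linear_combination (M * L ^ θ) * h7 + (2 * M * L ^ θ) * h6
  linarith

/-- `ζ` is either below `ε` or controlled by the critical nonlinearity, up to a logarithm. -/
lemma rpow_le_log_mul {q μ ε ζ : ℝ} (hμ : -1 ≤ μ) (hε : 0 < ε) (hζ : ε ≤ ζ) :
    ζ ^ q ≤ log (exp 1 + 1 / ε) * (ζ ^ q * log (exp 1 + 1 / ζ) ^ μ) := by
  have hζ0 : 0 < ζ := hε.trans_le hζ
  have h1 : 1 ≤ log (exp 1 + 1 / ζ) := by
    rw [le_log_iff_exp_le (by positivity)]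
    have : 0 < 1 / ζ := by positivity
    linarith
  have h2 : log (exp 1 + 1 / ζ) ≤ log (exp 1 + 1 / ε) := by
    refine log_le_log (by positivity) ?_
    have := one_div_le_one_div_of_le hε hζ
    linarith
  have h3 : (log (exp 1 + 1 / ζ))⁻¹ ≤ log (exp 1 + 1 / ζ) ^ μ := by
    rw [← rpow_neg_one]
    exact rpow_le_rpow_of_exponent_le h1 hμ
  have h4 : 1 ≤ log (exp 1 + 1 / ε) * log (exp 1 + 1 / ζ) ^ μ := by
    calc (1 : ℝ) = log (exp 1 + 1 / ζ) * (log (exp 1 + 1 / ζ))⁻¹ := by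
          rw [mul_inv_cancel₀ (by linarith)]
      _ ≤ _ := mul_le_mul h2 h3 (by positivity) (by linarith)
  have h5 : 0 ≤ ζ ^ q := by positivity
  nlinarith

lemma rpow_mul_pow_le {q s ε L ζ y G : ℝ} {N m : ℕ} (hq : 0 < q) (hs : 0 < s) (hε : 0 < ε)
    (hL : 0 ≤ L) (hζ : 0 ≤ ζ) (hy : 0 ≤ y) (hG : 0 ≤ G) (hG1 : G ≤ 1) (hNm : m ≤ N)
    (hN : N * (s / q) ≤ N - m) (h : ε ≤ ζ → ζ ^ q ≤ L * y) :
    ζ ^ s * G ^ (N - m) ≤ ε ^ s + L ^ (s / q) * (y * G ^ N) ^ (s / q) := by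
  have hR : 0 ≤ L ^ (s / q) * (y * G ^ N) ^ (s / q) := by positivity
  rcases le_total ζ ε with h' | h'
  · have h1 : ζ ^ s ≤ ε ^ s := rpow_le_rpow hζ h' hs.le
    have h2 : G ^ (N - m) ≤ 1 := pow_le_one₀ hG hG1
    have h3 : ζ ^ s * G ^ (N - m) ≤ ε ^ s * 1 := by gcongr
    linarith
  · have h1 : ζ ^ s ≤ L ^ (s / q) * y ^ (s / q) := by
      rw [← mul_rpow hL hy]
      calc ζ ^ s = (ζ ^ q) ^ (s / q) := by rw [← rpow_mul hζ, mul_div_cancel₀ _ hq.ne']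
        _ ≤ _ := rpow_le_rpow (by positivity) (h h') (by positivity)
    have h2 : G ^ (N - m) ≤ (G ^ N) ^ (s / q) := by
      rw [← rpow_natCast, ← rpow_natCast G N, ← rpow_mul hG, Nat.cast_sub hNm]
      exact rpow_le_rpow_of_exponent_ge' hG hG1 (by positivity) hN
    have h3 : ζ ^ s * G ^ (N - m) ≤ L ^ (s / q) * y ^ (s / q) * (G ^ N) ^ (s / q) := by gcongr
    rw [mul_rpow hy (by positivity), ← mul_assoc]
    have : 0 ≤ ε ^ s := by positivity
    linarith

lemma false_of_superlinear_growth {F : ℕ → ℝ} {c σ : ℝ} (hc : 0 < c) (hσ : 1 < σ) (j₀ : ℕ)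
    (hpos : ∀ j, j₀ ≤ j → 0 < F j)
    (hstep : ∀ j, j₀ ≤ j → F j + c * F j ^ σ / (j + 1) ≤ F (j + 1))
    (hbd : ∀ j, j₀ ≤ j → c * F j ^ (σ - 1) ≤ j + 1) : False := by
  have hmono : ∀ j, j₀ ≤ j → F j₀ ≤ F j := by
    intro j hj
    induction j, hj using Nat.le_induction with
    | base => rfl
    | succ j hj ih =>
      have := hpos j hj
      have h2 : 0 ≤ c * F j ^ σ / (j + 1) := by positivity
      linarith [hstep j hj]
  have hunb : Tendsto F atTop atTop := by
    set c₀ := c * F j₀ ^ σ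
    have hc₀ : 0 < c₀ := by have := hpos j₀ le_rfl; positivity
    have hsum : ∀ j, j₀ ≤ j →
        c₀ * (∑ i ∈ Finset.range j, 1 / ((i : ℝ) + 1))
          - c₀ * (∑ i ∈ Finset.range j₀, 1 / ((i : ℝ) + 1)) ≤ F j := by
      intro j hj
      induction j, hj using Nat.le_induction with
      | base => simpa using (hpos j₀ le_rfl).le
      | succ j hj ih =>
        rw [Finset.sum_range_succ]
        have h1 : F j₀ ^ σ ≤ F j ^ σ :=
          rpow_le_rpow (hpos j₀ le_rfl).le (hmono j hj) (by linarith)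
        have h2 : c₀ * (1 / ((j : ℝ) + 1)) ≤ c * F j ^ σ / (j + 1) := by
          rw [mul_one_div]
          exact div_le_div_of_nonneg_right (mul_le_mul_of_nonneg_left h1 hc.le) (by positivity)
        linarith [hstep j hj]
    have ht := tendsto_sum_range_one_div_nat_succ_atTop
    have ht' := tendsto_atTop_add_const_right atTop
      (-(c₀ * (∑ i ∈ Finset.range j₀, 1 / ((i : ℝ) + 1)))) (ht.const_mul_atTop hc₀)
    refine tendsto_atTop_mono' atTop ?_ ht'
    filter_upwards [eventually_ge_atTop j₀] with j hj
    simpa [sub_eq_add_neg] using hsum j hj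
  obtain ⟨K, hK⟩ := exists_nat_gt (1 / (σ - 1))
  have hσ' : 0 < σ - 1 := by linarith
  have hK1 : 1 < K * (σ - 1) := by rwa [div_lt_iff₀ hσ'] at hK
  have hev : ∀ᶠ j in atTop, (2 : ℝ) ^ K ≤ c * F j ^ (σ - 1) :=
    (((tendsto_rpow_atTop hσ').comp hunb).const_mul_atTop hc).eventually_ge_atTop _
  obtain ⟨j₁, hj₁⟩ := eventually_atTop.1 (hev.and (eventually_ge_atTop j₀))
  have hj₀₁ : ∀ j, j₁ ≤ j → j₀ ≤ j := fun j hj => (hj₁ j hj).2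
  have hbern : ∀ (k : ℕ) (x : ℝ), 0 ≤ x → x ≤ 1 → (1 + x) ^ k ≤ 1 + (2 ^ k - 1) * x := by
    intro k x hx hx1
    induction k with
    | zero => simp
    | succ k ih =>
      have h2 : (1 : ℝ) ≤ 2 ^ k := one_le_pow₀ one_le_two
      have h3 : 0 ≤ ((2 : ℝ) ^ k - 1) * x * (1 - x) :=
        mul_nonneg (mul_nonneg (by linarith) hx) (by linarith)
      rw [pow_succ, pow_succ]
      nlinarith [mul_le_mul_of_nonneg_right ih (by linarith : 0 ≤ 1 + x)]
  have hgrow : ∀ j, j₁ ≤ j → F j₁ / (j₁ + 1) ^ K * (j + 1) ^ K ≤ F j := by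
    intro j hj
    induction j, hj using Nat.le_induction with
    | base => rw [div_mul_cancel₀ _ (by positivity)]
    | succ j hj ih =>
      have hFj := hpos j (hj₀₁ j hj)
      have hx : (1 : ℝ) / (j + 1) ≤ 1 := by
        rw [div_le_one (by positivity)]
        linarith [(Nat.cast_nonneg j : (0 : ℝ) ≤ j)]
      have h1 := hbern K (1 / (j + 1)) (by positivity) hx
      have h2 : ((j + 1 : ℕ) + 1 : ℝ) ^ K = (j + 1) ^ K * (1 + 1 / (j + 1)) ^ K := by
        rw [← mul_pow]
        congr 1
        push_cast
        field_simp
      have h3 : F j * (1 + 2 ^ K * (1 / (j + 1))) ≤ F (j + 1) := by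
        have h4 : F j ^ σ = F j ^ (σ - 1) * F j := by
          rw [← rpow_add_one hFj.ne', sub_add_cancel]
        have h5 : F j * (2 ^ K * (1 / (j + 1))) ≤ c * F j ^ σ / (j + 1) := by
          rw [h4]
          calc F j * (2 ^ K * (1 / (j + 1))) = 2 ^ K * F j / (j + 1) := by ring
            _ ≤ (c * F j ^ (σ - 1)) * F j / (j + 1) := by
              gcongr
              exact (hj₁ j hj).1
            _ = _ := by ring
        linarith [hstep j (hj₀₁ j hj)]
      rw [h2, ← mul_assoc]
      refine le_trans ?_ h3
      refine mul_le_mul ih (h1.trans ?_) (by positivity) hFj.le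
      have : (0 : ℝ) ≤ 1 / ((j : ℝ) + 1) := by positivity
      nlinarith
  set b := F j₁ / (j₁ + 1) ^ K with hb
  have hb0 : 0 < b := by have := hpos j₁ (hj₀₁ j₁ le_rfl); positivity
  have hcontra : ∀ j : ℕ, j₁ ≤ j →
      c * b ^ (σ - 1) * ((j : ℝ) + 1) ^ (K * (σ - 1) - 1) ≤ 1 := by
    intro j hj
    have hj1 : (0 : ℝ) < (j : ℝ) + 1 := by positivity
    have h1 := hbd j (hj₀₁ j hj)
    have h2 : (b * (j + 1) ^ K) ^ (σ - 1) ≤ F j ^ (σ - 1) :=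
      rpow_le_rpow (by positivity) (hgrow j hj) hσ'.le
    rw [mul_rpow hb0.le (by positivity), ← rpow_natCast, ← rpow_mul hj1.le] at h2
    rw [rpow_sub_one hj1.ne', ← mul_div_assoc, div_le_one hj1]
    calc c * b ^ (σ - 1) * ((j : ℝ) + 1) ^ (K * (σ - 1))
        = c * (b ^ (σ - 1) * ((j : ℝ) + 1) ^ (K * (σ - 1))) := by ring
      _ ≤ c * F j ^ (σ - 1) := mul_le_mul_of_nonneg_left h2 hc.le
      _ ≤ _ := h1
  have htend : Tendsto (fun j : ℕ => c * b ^ (σ - 1) * ((j : ℝ) + 1) ^ (K * (σ - 1) - 1))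
      atTop atTop := by
    refine Tendsto.const_mul_atTop (by positivity) ?_
    exact (tendsto_rpow_atTop (by linarith)).comp
      (tendsto_atTop_add_const_right _ _ tendsto_natCast_atTop_atTop)
  obtain ⟨j, hj, hj'⟩ := ((htend.eventually_gt_atTop 1).and (eventually_ge_atTop j₁)).exists
  exact absurd (hcontra j hj') (not_le.2 hj)

lemma nonpos_of_energy_recursion {F E X δ : ℕ → ℝ} {K c θ₁ θ₂ : ℝ} (hK : 0 < K) (hc : 0 < c)
    (hθ₁ : 0 < θ₁) (hθ₁' : θ₁ < 1) (hθ₂ : 0 < θ₂) (hθ₂' : θ₂ < 1)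
    (hδ : Tendsto δ atTop (nhds 0)) (hX : ∀ j, 0 ≤ X j) (hFE : ∀ j, F j ≤ E j)
    (hXE : ∀ j, X j ≤ E j) (hFX : ∀ j, F j + X j ≤ F (j + 1))
    (hE : ∀ j, ∀ Y, 0 < Y → X j ≤ Y →
      E j ≤ K * (δ j + (c * (j + 1) * Y) ^ θ₁ + (c * (j + 1) * Y) ^ θ₂)) (j : ℕ) : F j ≤ 0 := by
  by_contra! hpos
  set c₀ := F j with hc₀
  have hmono : Monotone F := monotone_nat_of_le_succ fun i => by linarith [hX i, hFX i]
  have hsmall : ∃ z₀ > 0, ∀ Z, 0 < Z → Z < z₀ → K * (Z ^ θ₁ + Z ^ θ₂) < c₀ / 2 := by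
    have hcont : ContinuousAt (fun Z : ℝ => K * (Z ^ θ₁ + Z ^ θ₂)) 0 :=
      continuousAt_const.mul ((continuousAt_rpow_const _ _ (Or.inr hθ₁.le)).add
        (continuousAt_rpow_const _ _ (Or.inr hθ₂.le)))
    have h0 : K * ((0 : ℝ) ^ θ₁ + (0 : ℝ) ^ θ₂) < c₀ / 2 := by
      rw [zero_rpow hθ₁.ne', zero_rpow hθ₂.ne']
      linarith
    obtain ⟨z₀, hz₀, h⟩ := Metric.eventually_nhds_iff.1 (hcont.eventually_lt_const h0)
    refine ⟨z₀, hz₀, fun Z hZ hZ' => h ?_⟩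
    rwa [dist_zero_right, norm_eq_abs, abs_of_pos hZ]
  obtain ⟨z₀, hz₀, hsmall⟩ := hsmall
  have hδ' : ∀ᶠ i in atTop, K * δ i < c₀ / 2 := by
    have := hδ.const_mul K
    rw [mul_zero] at this
    exact this.eventually_lt_const (by linarith)
  obtain ⟨j₀, hj₀⟩ := eventually_atTop.1 (hδ'.and (eventually_ge_atTop j))
  have hFc : ∀ i, j₀ ≤ i → c₀ ≤ F i := fun i hi => hmono (hj₀ i hi).2
  have hE2 : ∀ i, j₀ ≤ i → ∀ Y, 0 < Y → X i ≤ Y →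
      E i / 2 ≤ K * ((c * (i + 1) * Y) ^ θ₁ + (c * (i + 1) * Y) ^ θ₂) := by
    intro i hi Y hY hXY
    have h1 := hE i Y hY hXY
    have h2 := (hj₀ i hi).1
    have h3 := hFc i hi
    have h4 := hFE i
    linarith
  have hz : ∀ i, j₀ ≤ i → ∀ Y, 0 < Y → X i ≤ Y → z₀ ≤ c * (i + 1) * Y := by
    intro i hi Y hY hXY
    by_contra! hlt
    have h1 := hsmall _ (by positivity) hlt
    have h2 := hE2 i hi Y hY hXY
    have h3 := hFc i hi
    have h4 := hFE i
    linarith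
  have hXpos : ∀ i, j₀ ≤ i → 0 < X i := by
    intro i hi
    by_contra! h
    have hci : 0 < c * ((i : ℝ) + 1) := by positivity
    have := hz i hi (z₀ / (2 * (c * (i + 1)))) (by positivity) (h.trans (by positivity))
    have h2 : c * ((i : ℝ) + 1) * (z₀ / (2 * (c * (i + 1)))) = z₀ / 2 := by field_simp
    linarith
  set τ := max θ₁ θ₂ with hτ
  have hτ0 : 0 < τ := lt_max_of_lt_left hθ₁
  have hτ1 : τ < 1 := max_lt hθ₁' hθ₂'
  set K' := 2 * K * (z₀ ^ (θ₁ - τ) + z₀ ^ (θ₂ - τ)) with hK'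
  have hK'0 : 0 < K' := by positivity
  have hpow : ∀ Z θ : ℝ, z₀ ≤ Z → θ ≤ τ → Z ^ θ ≤ z₀ ^ (θ - τ) * Z ^ τ := by
    intro Z θ hZ hθ
    have hZ0 : 0 < Z := lt_of_lt_of_le hz₀ hZ
    calc Z ^ θ = Z ^ (θ - τ) * Z ^ τ := by rw [← rpow_add hZ0, sub_add_cancel]
      _ ≤ _ := by
        exact mul_le_mul_of_nonneg_right
          (rpow_le_rpow_of_nonpos hz₀ hZ (by linarith)) (by positivity)
  have hE3 : ∀ i, j₀ ≤ i → E i ≤ K' * (c * (i + 1) * X i) ^ τ := by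
    intro i hi
    have h1 := hE2 i hi (X i) (hXpos i hi) le_rfl
    have h2 := hz i hi (X i) (hXpos i hi) le_rfl
    have h3 := hpow _ θ₁ h2 (le_max_left _ _)
    have h4 := hpow _ θ₂ h2 (le_max_right _ _)
    have h5 := mul_le_mul_of_nonneg_left (add_le_add h3 h4) hK.le
    rw [hK']
    linarith
  set σ := τ⁻¹ with hσ
  have hσ1 : 1 < σ := (one_lt_inv₀ hτ0).2 hτ1
  set c' := (K' ^ σ * c)⁻¹ with hc'
  have hc'0 : 0 < c' := by positivity
  have hX3 : ∀ i, j₀ ≤ i → c' * E i ^ σ / (i + 1) ≤ X i := by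
    intro i hi
    have hEi : 0 ≤ E i := by linarith [hFc i hi, hFE i]
    have hXi := hXpos i hi
    have h1 := rpow_le_rpow hEi (hE3 i hi) (by positivity : 0 ≤ σ)
    rw [mul_rpow hK'0.le (by positivity), ← rpow_mul (by positivity), hσ,
      mul_inv_cancel₀ hτ0.ne', rpow_one, ← hσ] at h1
    rw [div_le_iff₀ (by positivity), hc', inv_mul_le_iff₀ (by positivity)]
    linarith
  refine false_of_superlinear_growth hc'0 hσ1 j₀ (fun i hi => hpos.trans_le (hFc i hi))
    (fun i hi => ?_) (fun i hi => ?_)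
  · have h1 := hX3 i hi
    have h2 : F i ^ σ ≤ E i ^ σ :=
      rpow_le_rpow (hpos.trans_le (hFc i hi)).le (hFE i) (by positivity)
    have h3 : c' * F i ^ σ / (i + 1) ≤ c' * E i ^ σ / (i + 1) := by gcongr
    linarith [hFX i]
  · have hEi : 0 < E i := by linarith [hFc i hi, hFE i]
    have h1 := (hX3 i hi).trans (hXE i)
    have h2 : F i ^ (σ - 1) ≤ E i ^ (σ - 1) :=
      rpow_le_rpow (hpos.trans_le (hFc i hi)).le (hFE i) (by linarith)
    rw [div_le_iff₀ (by positivity)] at h1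
    have h3 : c' * E i ^ (σ - 1) ≤ i + 1 := by
      rw [rpow_sub_one hEi.ne', ← mul_div_assoc, div_le_iff₀ hEi]
      linarith
    exact (mul_le_mul_of_nonneg_left h2 hc'0.le).trans h3

lemma norm_dilate_lt_iff {n : ℕ} {R T b : ℝ} (hR : 0 < R) (hT : 0 < T) {z : Spc n × ℝ}
    (hz : 0 < z.2) : ‖dilate n R⁻¹ T⁻¹ z‖ < b ↔ ‖z.1‖ < b * R ∧ z.2 < b * T := by
  rw [dilate, Prod.norm_def, max_lt_iff, norm_smul, norm_eq_abs, norm_eq_abs, abs_mul,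
    abs_of_pos (inv_pos.2 hR), abs_of_pos (inv_pos.2 hT), abs_of_pos hz,
    inv_mul_lt_iff₀ hR, inv_mul_lt_iff₀ hT, mul_comm b R, mul_comm b T]

/-- The difference of the cylinder of size `(2R, 2T)` and the one of size `(R, T)`. -/
def shell (n : ℕ) (R T : ℝ) : Set (Spc n × ℝ) :=
  (ball0 n (2 * R) ×ˢ Ioo 0 (2 * T)) \ (ball0 n R ×ˢ Ioo 0 T)

lemma measurableSet_halfSp (n : ℕ) : MeasurableSet (halfSp n) :=
  measurableSet_lt measurable_const measurable_snd

lemma measurableSet_shell (n : ℕ) (R T : ℝ) : MeasurableSet (shell n R T) :=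
  (Metric.isOpen_ball.measurableSet.prod measurableSet_Ioo).diff
    (Metric.isOpen_ball.measurableSet.prod measurableSet_Ioo)

lemma shell_subset_halfSp (n : ℕ) (R T : ℝ) : shell n R T ⊆ halfSp n := fun _ hz => hz.1.2.1

lemma mem_shell_iff {n : ℕ} {R T : ℝ} (hR : 0 < R) (hT : 0 < T) {z : Spc n × ℝ}
    (hz : 0 < z.2) : z ∈ shell n R T ↔
      ‖dilate n R⁻¹ T⁻¹ z‖ < 2 ∧ ¬ ‖dilate n R⁻¹ T⁻¹ z‖ < 1 := by
  rw [norm_dilate_lt_iff hR hT hz, norm_dilate_lt_iff hR hT hz]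
  simp [shell, ball0, hz]

lemma volume_shell_le (n : ℕ) {R : ℝ} (hR : 0 < R) (T : ℝ) :
    volume (shell n R T) ≤ ENNReal.ofReal
      (2 ^ (n + 1) * volume.real (Metric.ball (0 : Spc n) 1) * (R ^ n * T)) := by
  refine (measure_mono sdiff_subset).trans ?_
  rw [Measure.volume_eq_prod, Measure.prod_prod, ball0, Real.volume_Ioo,
    Measure.addHaar_ball_of_pos _ _ (by positivity : 0 < 2 * R), finrank_euclideanSpace,
    Fintype.card_fin, ← ENNReal.ofReal_toReal (measure_ball_lt_top (μ := volume)).ne,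
    ← ENNReal.ofReal_mul (by positivity), ← ENNReal.ofReal_mul (by positivity)]
  refine ENNReal.ofReal_le_ofReal (le_of_eq ?_)
  rw [Measure.real]
  ring

lemma integrableOn_mul_of_hasCompactSupport {n : ℕ} {h φ : Spc n × ℝ → ℝ}
    (hh : ∀ r : ℝ, 0 < r → IntegrableOn h (cyl n r 1)) (hφ : Continuous φ)
    (hφc : HasCompactSupport φ) : IntegrableOn (fun z => h z * φ z) (halfSp n) := by
  obtain ⟨r, hr0, hr⟩ := hφc.isBounded.subset_ball_lt 0 0
  obtain ⟨b, hb⟩ := hφ.bounded_above_of_compact_support hφc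
  have h1 : IntegrableOn (fun z => h z * φ z) (cyl n r 1) :=
    (hh r hr0).mul_bdd hφ.aestronglyMeasurable (ae_of_all _ hb)
  refine h1.of_forall_sdiff_eq_zero (measurableSet_halfSp n) fun z hz => ?_
  by_cases hzs : z ∈ tsupport φ
  swap
  · rw [image_eq_zero_of_notMem_tsupport hzs, mul_zero]
  exfalso
  have h2 := hr hzs
  rw [mem_ball_zero_iff, Prod.norm_def, max_lt_iff] at h2
  refine hz.2 ⟨by simpa [ball0] using h2.1, hz.1, ?_⟩
  rw [rpow_one]
  exact (le_abs_self _).trans_lt h2.2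

lemma hasCompactSupport_dilate {n : ℕ} {G : Spc n × ℝ → ℝ} {N : ℕ} (hN : N ≠ 0)
    (hG : ∀ z, 2 ≤ ‖z‖ → G z = 0) {R T : ℝ} (hR : 0 < R) (hT : 0 < T) :
    HasCompactSupport fun z => G (dilate n R⁻¹ T⁻¹ z) ^ N := by
  refine HasCompactSupport.intro
    ((isCompact_closedBall (0 : Spc n) (2 * R)).prod (isCompact_closedBall (0 : ℝ) (2 * T))) ?_
  intro z hz
  rw [hG, zero_pow hN]
  by_contra! h
  rw [dilate, Prod.norm_def, max_lt_iff, norm_smul, norm_eq_abs, norm_eq_abs, abs_mul,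
    abs_of_pos (inv_pos.2 hR), abs_of_pos (inv_pos.2 hT),
    inv_mul_lt_iff₀ hR, inv_mul_lt_iff₀ hT] at h
  refine hz ⟨?_, ?_⟩
  · rw [mem_closedBall_zero_iff]
    linarith [h.1]
  · rw [mem_closedBall_zero_iff, norm_eq_abs]
    linarith [h.2]

/-- Bound for an integrand carried by a derivative of the dilated cutoff. -/
lemma abs_integral_le_of_cutoff {n m N : ℕ} {G h v g : Spc n × ℝ → ℝ}
    (hG0 : ∀ z, 0 ≤ G z) (hG1 : ∀ z, G z ≤ 1) (hG2 : ∀ z, 2 ≤ ‖z‖ → G z = 0) (hmN : m < N)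
    (hh : ∀ z, 0 ≤ h z) (hv : ∀ z, 0 ≤ v z) {R T V Y q s ε L M : ℝ} (hR : 0 < R) (hT : 0 < T)
    (hw : IntegrableOn (fun z => h z * G (dilate n R⁻¹ T⁻¹ z) ^ N) (halfSp n))
    (hV : 0 < V) (hDV : volume (shell n R T) ≤ ENNReal.ofReal V) (hY : 0 < Y)
    (hXY : ∫ z in shell n R T, h z * G (dilate n R⁻¹ T⁻¹ z) ^ N ≤ Y)
    (hs : 0 < s) (hsq : s < q) (hNs : N * (s / q) ≤ N - m) (hε : 0 < ε) (hL : 0 ≤ L)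
    (hvh : ∀ z, ε ≤ v z → v z ^ q ≤ L * h z) (hM : 0 ≤ M)
    (hg : ∀ᵐ z ∂volume.restrict (halfSp n),
      |g z| ≤ M * (v z ^ s * G (dilate n R⁻¹ T⁻¹ z) ^ (N - m)))
    (hg0 : ∀ z, ‖dilate n R⁻¹ T⁻¹ z‖ < 1 → g z = 0) :
    |∫ z in halfSp n, g z| ≤
      M * (ε ^ s * V + 2 * ((L * Y) ^ (s / q) * V ^ (1 - s / q))) := by
  have hq : 0 < q := hs.trans hsq
  refine abs_integral_le_of_rpow_bound (measurableSet_shell n R T) (shell_subset_halfSp n R T)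
    hV hDV (hw.mono_set (shell_subset_halfSp n R T))
    (fun z => mul_nonneg (hh z) (pow_nonneg (hG0 _) _)) hY hXY (by positivity)
    ((div_lt_one hq).2 hsq) hM (by positivity) hL ?_
  filter_upwards [hg, ae_restrict_mem (measurableSet_halfSp n)] with z hz hzH
  by_cases hzs : z ∈ shell n R T
  · rw [indicator_of_mem hzs]
    exact hz.trans (mul_le_mul_of_nonneg_left (rpow_mul_pow_le hq hs hε hL (hv z) (hh z)
      (hG0 _) (hG1 _) hmN.le hNs (hvh z)) hM)
  · rw [indicator_of_notMem hzs]
    rw [mem_shell_iff hR hT hzH, not_and_or, not_not, not_lt] at hzs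
    rcases hzs with h2 | h1
    · rwa [hG2 _ h2, zero_pow (by omega), mul_zero, mul_zero] at hz
    · rw [hg0 z h1, abs_zero]

/-- The powers of the scale `R` cancel for the critical exponent `q = p + m / n`. -/
lemma critical_scaling (n m : ℕ) (hn : 1 ≤ n) {p q κ c₀ R : ℝ} (hq0 : 0 < q)
    (hq : q = p + (m : ℝ) / n) (hκ : κ = n * (q - 1)) (hc₀pos : 0 < c₀) (hR : 0 < R) :
    (R ^ κ)⁻¹ * ((1 / R ^ (n + 1)) ^ (1 : ℝ) * (c₀ * (R ^ n * R ^ κ))) = c₀ * R⁻¹ ∧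
    (R ^ m)⁻¹ * ((1 / R ^ (n + 1)) ^ p * (c₀ * (R ^ n * R ^ κ))) = c₀ * R ^ (-p) ∧
    (R ^ κ)⁻¹ * (c₀ * (R ^ n * R ^ κ)) ^ (1 - 1 / q) = c₀ ^ (1 - 1 / q) ∧
    (R ^ m)⁻¹ * (c₀ * (R ^ n * R ^ κ)) ^ (1 - p / q) = c₀ ^ (1 - p / q) := by
  have hn0 : (0 : ℝ) < n := by exact_mod_cast hn
  have hVpow : c₀ * (R ^ n * R ^ κ) = c₀ * R ^ ((n : ℝ) * q) := by
    rw [← rpow_natCast, ← rpow_add hR, hκ]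
    congr 2
    ring
  have hεpow : 1 / R ^ (n + 1) = R ^ (-((n : ℝ) + 1)) := by
    rw [rpow_neg hR.le, one_div, ← rpow_natCast]
    push_cast
    rfl
  have hTpow : (R ^ κ)⁻¹ = R ^ (-κ) := by rw [rpow_neg hR.le]
  have hmpow : (R ^ m)⁻¹ = R ^ (-(m : ℝ)) := by rw [rpow_neg hR.le, rpow_natCast]
  have hnq : (n : ℝ) * q = n * p + m := by
    rw [hq]
    field_simp
  refine ⟨?_, ?_, ?_, ?_⟩
  · rw [rpow_one, hεpow, hVpow, hTpow, ← rpow_neg_one R]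
    have : R ^ (-κ) * R ^ (-((n : ℝ) + 1)) * R ^ ((n : ℝ) * q) = R ^ (-1 : ℝ) := by
      rw [← rpow_add hR, ← rpow_add hR, hκ]
      congr 1
      ring
    linear_combination c₀ * this
  · rw [hεpow, hVpow, hmpow, ← rpow_mul hR.le]
    have : R ^ (-(m : ℝ)) * R ^ (-((n : ℝ) + 1) * p) * R ^ ((n : ℝ) * q) = R ^ (-p) := by
      rw [← rpow_add hR, ← rpow_add hR]
      congr 1
      linear_combination hnq
    linear_combination c₀ * this
  · rw [hVpow, hTpow, mul_rpow hc₀pos.le (by positivity), ← rpow_mul hR.le, mul_left_comm,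
      ← rpow_add hR]
    have : -κ + n * q * (1 - 1 / q) = 0 := by
      have h1 : q * (1 / q) = 1 := mul_div_cancel₀ _ hq0.ne'
      linear_combination -hκ - (n : ℝ) * h1
    rw [this, rpow_zero, mul_one]
  · rw [hVpow, hmpow, mul_rpow hc₀pos.le (by positivity), ← rpow_mul hR.le, mul_left_comm,
      ← rpow_add hR]
    have : -(m : ℝ) + n * q * (1 - p / q) = 0 := by
      have h1 : q * (p / q) = p := mul_div_cancel₀ _ hq0.ne'
      linear_combination hnq - (n : ℝ) * h1
    rw [this, rpow_zero, mul_one]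

/-- The energy inequality obtained by testing with a power of the dilated cutoff. -/
lemma exists_energy_estimate
    (n m : ℕ) (hn : 1 ≤ n) (hm : 1 ≤ m) (A p : ℝ) (hA : 0 < A) (hp : 0 < p)
    (a : (Fin n → ℕ) → Spc n × ℝ → ℝ → ℝ) (ha : GoodCoeffs n m A p a)
    (u0 : Spc n → ℝ) (hu0nn : ∀ᵐ x ∂(volume : Measure (Spc n)), 0 ≤ u0 x)
    (q κ : ℝ) (hq : q = p + (m : ℝ) / n) (hκ : κ = n * (q - 1)) (hq1 : 1 < q)
    (f : ℝ → ℝ) (hf : ∀ ζ, 0 ≤ ζ → 0 ≤ f ζ)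
    (hfL : ∀ ε ζ : ℝ, 0 < ε → ε ≤ ζ → ζ ^ q ≤ log (exp 1 + 1 / ε) * f ζ)
    (u : Spc n × ℝ → ℝ) (hu : IsGlobalWeakSol n 1 m p a f (fun _ => u0) u) :
    ∃ (Φ : ℝ → Spc n × ℝ → ℝ) (K : ℝ), 0 < K ∧ ∀ R : ℝ, 1 ≤ R →
      (∀ z, 0 ≤ Φ R z) ∧ (∀ z, Φ R z ≤ 1) ∧ (∀ z ∈ cyl n R κ, Φ R z = 1) ∧
      IntegrableOn (fun z => f |u z| * Φ R z) (halfSp n) ∧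
      ∀ Y : ℝ, 0 < Y → ∫ z in shell n R (R ^ κ), f |u z| * Φ R z ≤ Y →
        ∫ z in halfSp n, f |u z| * Φ R z ≤
          K * (R⁻¹ + R ^ (-p) + (log (exp 1 + R ^ (n + 1)) * Y) ^ (1 / q)
            + (log (exp 1 + R ^ (n + 1)) * Y) ^ (p / q)) := by
  obtain ⟨hu1, hup, huf, hweak⟩ := hu
  have hn0 : (0 : ℝ) < n := by exact_mod_cast hn
  have hm0 : (0 : ℝ) < m := by exact_mod_cast hm
  have hq0 : 0 < q := by linarith
  have hpq : p < q := by
    have : 0 < (m : ℝ) / n := by positivity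
    linarith
  have hθ₁ : 1 / q < 1 := (div_lt_one hq0).2 hq1
  have hθ₂ : p / q < 1 := (div_lt_one hq0).2 hpq
  obtain ⟨N, hN⟩ := exists_nat_gt (max (m : ℝ) (max (m / (1 - 1 / q)) (m / (1 - p / q))))
  rw [max_lt_iff, max_lt_iff, div_lt_iff₀ (by linarith), div_lt_iff₀ (by linarith)] at hN
  obtain ⟨hmN, hN₁, hN₂⟩ := hN
  replace hmN : m < N := by exact_mod_cast hmN
  obtain ⟨G, C, hC, hGs, hG0, hG1, hGone, hGzero, hGt, hGt0, hGα⟩ := exists_cutoff n m N hm hmN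
  set c₀ : ℝ := 2 ^ (n + 1) * volume.real (Metric.ball (0 : Spc n) 1) with hc₀
  have hc₀pos : 0 < c₀ := by
    have : 0 < volume.real (Metric.ball (0 : Spc n) 1) :=
      ENNReal.toReal_pos (Metric.measure_ball_pos _ _ one_pos).ne' measure_ball_lt_top.ne
    positivity
  set M : ℝ := (mIdx n m).card * A * C with hM
  have hM0 : 0 ≤ M := by positivity
  set K : ℝ := 1 + C * c₀ + M * c₀ + 2 * C * c₀ ^ (1 - 1 / q) + 2 * M * c₀ ^ (1 - p / q) with hK
  refine ⟨fun R z => G (dilate n R⁻¹ (R ^ κ)⁻¹ z) ^ N, K, by positivity, fun R hR1 => ?_⟩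
  have hR : 0 < R := by linarith
  set T := R ^ κ with hT
  have hT0 : 0 < T := by positivity
  set φ : Spc n × ℝ → ℝ := fun z => G (dilate n R⁻¹ T⁻¹ z) ^ N with hφ
  have hφ0 : ∀ z, 0 ≤ φ z := fun z => pow_nonneg (hG0 _) _
  have hφs : ContDiff ℝ (⊤ : ℕ∞) φ := by
    refine (hGs.comp ?_).pow N
    exact (contDiff_fst.const_smul R⁻¹).prodMk (contDiff_const.mul contDiff_snd)
  have hφc : HasCompactSupport φ := hasCompactSupport_dilate (by omega) hGzero hR hT0
  have hw := integrableOn_mul_of_hasCompactSupport huf hφs.continuous hφc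
  refine ⟨hφ0, fun z => pow_le_one₀ (hG0 _) (hG1 _), ?_, hw, fun Y hY hXY => ?_⟩
  · intro z hz
    have h1 : ‖dilate n R⁻¹ T⁻¹ z‖ < 1 := by
      rw [norm_dilate_lt_iff hR hT0 hz.2.1, one_mul, one_mul]
      exact ⟨by simpa [ball0] using hz.1, hz.2.2⟩
    simp only [← hT, hGone _ h1, one_pow]
  set ε : ℝ := 1 / R ^ (n + 1) with hε
  have hε0 : 0 < ε := by positivity
  set L := log (exp 1 + R ^ (n + 1)) with hL
  have hL0 : 0 ≤ L := by
    refine log_nonneg ?_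
    have h1 : (1 : ℝ) ≤ R ^ (n + 1) := one_le_pow₀ hR1
    linarith [exp_pos 1]
  have hvh : ∀ z, ε ≤ |u z| → |u z| ^ q ≤ L * f |u z| := by
    intro z hz
    have := hfL ε _ hε0 hz
    rwa [hε, one_div_one_div] at this
  set V := c₀ * (R ^ n * T) with hV
  have hV0 : 0 < V := by positivity
  have hDV : volume (shell n R T) ≤ ENNReal.ofReal V := volume_shell_le n hR T
  have hNs₁ : (N : ℝ) * (1 / q) ≤ N - m := by linarith
  have hNs₂ : (N : ℝ) * (p / q) ≤ N - m := by linarith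
  have htime : |∫ z in halfSp n, (-1 : ℝ) ^ 1 * u z * tDeriv n φ z| ≤
      T⁻¹ * C * (ε ^ (1 : ℝ) * V + 2 * ((L * Y) ^ (1 / q) * V ^ (1 - 1 / q))) := by
    refine abs_integral_le_of_cutoff hG0 hG1 hGzero hmN (h := fun z => f |u z|)
      (v := fun z => |u z|) (fun z => hf _ (abs_nonneg _)) (fun z => abs_nonneg _) hR hT0 hw hV0
      hDV hY hXY one_pos hq1 hNs₁ hε0 hL0 hvh (by positivity) (ae_of_all _ fun z => ?_) ?_
    · rw [hφ, tDeriv_comp_dilate n R⁻¹ T⁻¹ (fun z => G z ^ N), abs_mul, abs_mul, abs_mul,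
        abs_of_pos (inv_pos.2 hT0), rpow_one]
      have h1 := mul_le_mul_of_nonneg_left (hGt (dilate n R⁻¹ T⁻¹ z))
        (by positivity : 0 ≤ |u z| * T⁻¹)
      simp only [pow_one, abs_neg, abs_one, one_mul]
      linarith
    · intro z hz
      rw [hφ, tDeriv_comp_dilate n R⁻¹ T⁻¹ (fun z => G z ^ N)]
      simp only [hGt0 _ hz, mul_zero]
  have hspace : |∫ z in halfSp n, ∑ α ∈ mIdx n m, (-1 : ℝ) ^ m * a α z (u z) * mDeriv n α φ z| ≤
      (R ^ m)⁻¹ * M * (ε ^ p * V + 2 * ((L * Y) ^ (p / q) * V ^ (1 - p / q))) := by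
    have hmD : ∀ α ∈ mIdx n m, mDeriv n α φ = fun z =>
        (R ^ m)⁻¹ * mDeriv n α (fun z => G z ^ N) (dilate n R⁻¹ T⁻¹ z) := by
      intro α hα
      rw [hφ, mDeriv_comp_dilate n α R⁻¹ T⁻¹ (fun z => G z ^ N), (Finset.mem_filter.1 hα).2,
        inv_pow]
    refine abs_integral_le_of_cutoff hG0 hG1 hGzero hmN (h := fun z => f |u z|)
      (v := fun z => |u z|) (fun z => hf _ (abs_nonneg _)) (fun z => abs_nonneg _) hR hT0 hw hV0
      hDV hY hXY hp hpq hNs₂ hε0 hL0 hvh (by positivity) ?_ ?_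
    · have hall : ∀ᵐ z ∂volume.restrict (halfSp n), ∀ α ∈ mIdx n m,
          |a α z (u z)| ≤ A * |u z| ^ p := by
        rw [Filter.eventually_all_finset]
        exact fun α hα => (ha α hα).2.2.mono fun z hz => hz _
      filter_upwards [hall] with z hz
      have hterm : ∀ α ∈ mIdx n m, |(-1 : ℝ) ^ m * a α z (u z) * mDeriv n α φ z| ≤
          (A * |u z| ^ p) * ((R ^ m)⁻¹ * (C * G (dilate n R⁻¹ T⁻¹ z) ^ (N - m))) := by
        intro α hα
        rw [hmD α hα, abs_mul, abs_mul, abs_mul, abs_pow, abs_neg, abs_one, one_pow, one_mul,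
          abs_of_pos (by positivity : 0 < (R ^ m)⁻¹)]
        exact mul_le_mul (hz α hα) (mul_le_mul_of_nonneg_left ((hGα α hα).1 _) (by positivity))
          (by positivity) (by positivity)
      refine (Finset.abs_sum_le_sum_abs _ _).trans ((Finset.sum_le_sum hterm).trans (le_of_eq ?_))
      rw [Finset.sum_const, nsmul_eq_mul, hM]
      ring
    · intro z hz
      refine Finset.sum_eq_zero fun α hα => ?_
      rw [hmD α hα]
      simp only [(hGα α hα).2 _ hz, mul_zero]
  have hinit : 0 ≤ ∫ x : Spc n, ∑ i ∈ Finset.range 1,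
      (-1 : ℝ) ^ i * (fun _ => u0) (1 - 1 - i) x * (tDeriv n)^[i] φ (x, 0) := by
    refine integral_nonneg_of_ae ?_
    filter_upwards [hu0nn] with x hx
    simpa using mul_nonneg hx (hφ0 (x, 0))
  have hmain := hweak φ hφs hφc hφ0
  rw [Function.iterate_one] at hmain
  obtain ⟨e1, e2, e3, e4⟩ := critical_scaling n m hn hq0 hq hκ hc₀pos hR
  rw [← hT, ← hV, ← hε] at e1
  rw [← hT, ← hV, ← hε] at e2
  rw [← hT, ← hV] at e3
  rw [← hT, ← hV] at e4
  set Z₁ := (L * Y) ^ (1 / q) with hZ₁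
  set Z₂ := (L * Y) ^ (p / q) with hZ₂
  have hZ₁0 : 0 ≤ Z₁ := by positivity
  have hZ₂0 : 0 ≤ Z₂ := by positivity
  have f1 : T⁻¹ * C * (ε ^ (1 : ℝ) * V + 2 * (Z₁ * V ^ (1 - 1 / q))) =
      C * c₀ * R⁻¹ + 2 * C * c₀ ^ (1 - 1 / q) * Z₁ := by
    linear_combination C * e1 + 2 * C * Z₁ * e3
  have f2 : (R ^ m)⁻¹ * M * (ε ^ p * V + 2 * (Z₂ * V ^ (1 - p / q))) =
      M * c₀ * R ^ (-p) + 2 * M * c₀ ^ (1 - p / q) * Z₂ := by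
    linear_combination M * e2 + 2 * M * Z₂ * e4
  rw [f1] at htime
  rw [f2] at hspace
  have g1 := (abs_le.1 htime).2
  have g2 := (abs_le.1 hspace).1
  have n1 : 0 ≤ C * c₀ := by positivity
  have n2 : 0 ≤ M * c₀ := by positivity
  have n3 : 0 ≤ 2 * C * c₀ ^ (1 - 1 / q) := by positivity
  have n4 : 0 ≤ 2 * M * c₀ ^ (1 - p / q) := by positivity
  have k1 : C * c₀ * R⁻¹ ≤ K * R⁻¹ :=
    mul_le_mul_of_nonneg_right (by linarith) (by positivity)
  have k2 : M * c₀ * R ^ (-p) ≤ K * R ^ (-p) :=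
    mul_le_mul_of_nonneg_right (by linarith) (by positivity)
  have k3 : 2 * C * c₀ ^ (1 - 1 / q) * Z₁ ≤ K * Z₁ :=
    mul_le_mul_of_nonneg_right (by linarith) hZ₁0
  have k4 : 2 * M * c₀ ^ (1 - p / q) * Z₂ ≤ K * Z₂ :=
    mul_le_mul_of_nonneg_right (by linarith) hZ₂0
  have hstep := (le_add_of_nonneg_left hinit).trans (hmain.le.trans (sub_le_sub g1 g2))
  refine hstep.trans ?_
  linarith

/-- **Example 2.2.** For the parabolic problem with the critical nonlinearity
`f(ζ) = ζ^{p + m/n} log^μ (e + 1/ζ)` (and `f(0) = 0`), if `μ ≥ -1` then any global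
weak solution is trivial. -/
theorem blowup_critical_log_nonlinearity
    (n m : ℕ) (hn : 1 ≤ n) (hm : 1 ≤ m)
    (A p : ℝ) (hA : 0 < A) (hp : 0 < p)
    (a : (Fin n → ℕ) → Spc n × ℝ → ℝ → ℝ) (ha : GoodCoeffs n m A p a)
    (u0 : Spc n → ℝ) (hu0 : L1locInit n u0)
    (hu0nn : ∀ᵐ x ∂(volume : Measure (Spc n)), 0 ≤ u0 x)
    (μ : ℝ) (hμ : -1 ≤ μ)
    (hcrit : 1 < p + (m : ℝ) / (n : ℝ))
    (f : ℝ → ℝ) (hf0 : f 0 = 0)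
    (hfdef : ∀ ζ : ℝ, 0 < ζ →
      f ζ = ζ ^ (p + (m : ℝ) / (n : ℝ)) * Real.log (Real.exp 1 + 1 / ζ) ^ μ)
    (u : Spc n × ℝ → ℝ)
    (hu : IsGlobalWeakSol n 1 m p a f (fun _ => u0) u) :
    TrivialSol n u := by
  set q : ℝ := p + (m : ℝ) / (n : ℝ) with hq
  set κ : ℝ := n * (q - 1) with hκ
  have hn0 : (0 : ℝ) < n := by exact_mod_cast hn
  have hm0 : (0 : ℝ) < m := by exact_mod_cast hm
  have hq0 : 0 < q := by linarith
  have hpq : p < q := by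
    have : 0 < (m : ℝ) / n := by positivity
    linarith
  have hκ0 : 0 < κ := mul_pos hn0 (by linarith)
  have hlog : ∀ ζ : ℝ, 0 < ζ → 0 < log (exp 1 + 1 / ζ) := fun ζ hζ => by
    refine log_pos ?_
    have h1 : 0 < 1 / ζ := by positivity
    linarith [add_one_le_exp (1 : ℝ)]
  have hfpos : ∀ ζ : ℝ, 0 < ζ → 0 < f ζ := fun ζ hζ => by
    have := hlog ζ hζ
    rw [hfdef ζ hζ]
    positivity
  have hf : ∀ ζ : ℝ, 0 ≤ ζ → 0 ≤ f ζ := fun ζ hζ => by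
    rcases hζ.eq_or_lt with rfl | h
    · exact hf0.ge
    · exact (hfpos ζ h).le
  have hfL : ∀ ε ζ : ℝ, 0 < ε → ε ≤ ζ → ζ ^ q ≤ log (exp 1 + 1 / ε) * f ζ := by
    intro ε ζ hε hζ
    rw [hfdef ζ (hε.trans_le hζ)]
    exact rpow_le_log_mul hμ hε hζ
  obtain ⟨Φ, K, hK, hΦ⟩ := exists_energy_estimate n m hn hm A p hA hp a ha u0 hu0nn q κ hq hκ
    hcrit f hf hfL u hu
  set h : Spc n × ℝ → ℝ := fun z => f |u z| with hh
  have hh0 : ∀ z, 0 ≤ h z := fun z => hf _ (abs_nonneg _)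
  have hcyl_meas : ∀ r, MeasurableSet (cyl n r κ) := fun r =>
    Metric.isOpen_ball.measurableSet.prod measurableSet_Ioo
  have hcyl_sub : ∀ r, cyl n r κ ⊆ halfSp n := fun r z hz => hz.2.1
  have hint : ∀ r s : ℝ, IntegrableOn h (ball0 n r ×ˢ Ioo 0 s) := by
    intro r s
    refine (hu.2.2.1 (max 1 (max r s)) (by positivity)).mono_set (prod_mono ?_ ?_)
    · exact Metric.ball_subset_ball (by simp)
    · rw [rpow_one]
      exact Ioo_subset_Ioo_right (by simp)
  set b : ℝ := max 2 (2 ^ (1 / κ)) with hb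
  have hb2 : 2 ≤ b := le_max_left _ _
  have hbκ : 2 ≤ b ^ κ := by
    calc (2 : ℝ) = (2 ^ (1 / κ)) ^ κ := by
          rw [← rpow_mul zero_le_two, one_div_mul_cancel hκ0.ne', rpow_one]
      _ ≤ b ^ κ := rpow_le_rpow (by positivity) (le_max_right _ _) hκ0.le
  have hb1 : 1 ≤ b := by linarith
  have hbj : ∀ j : ℕ, 1 ≤ b ^ j := fun j => one_le_pow₀ hb1
  set c : ℝ := log 4 + (n + 1) * log b with hc
  have hlogb : 0 < log b := log_pos (by linarith)
  have hlog4 : 0 < log 4 := log_pos (by norm_num)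
  have hc0 : 0 < c := by positivity
  have hL : ∀ j : ℕ, log (exp 1 + (b ^ j) ^ (n + 1)) ≤ c * (j + 1) := by
    intro j
    have h1 : 1 ≤ (b ^ j) ^ (n + 1) := one_le_pow₀ (hbj j)
    have h2 : exp 1 + (b ^ j) ^ (n + 1) ≤ 4 * (b ^ j) ^ (n + 1) := by
      linarith [exp_one_lt_d9]
    have h3 := log_le_log (by positivity) h2
    rw [log_mul (by norm_num) (by positivity), log_pow, log_pow] at h3
    push_cast at h3
    have h4 : (0 : ℝ) ≤ j * log 4 := by positivity
    have h5 : 0 ≤ ((n : ℝ) + 1) * log b := by positivity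
    rw [hc]
    linarith
  have hL0 : ∀ j : ℕ, 0 ≤ log (exp 1 + (b ^ j) ^ (n + 1)) := fun j =>
    log_nonneg (by
      have h1 : 1 ≤ (b ^ j) ^ (n + 1) := one_le_pow₀ (hbj j)
      linarith [exp_pos 1])
  have hFle : ∀ j : ℕ, ∫ z in cyl n (b ^ j) κ, h z ≤ 0 := by
    have hsub : ∀ j : ℕ, shell n (b ^ j) ((b ^ j) ^ κ) ⊆ halfSp n := fun j =>
      shell_subset_halfSp _ _ _
    have hw0 : ∀ (j : ℕ) z, 0 ≤ h z * Φ (b ^ j) z := fun j z =>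
      mul_nonneg (hh0 z) ((hΦ _ (hbj j)).1 z)
    refine nonpos_of_energy_recursion (F := fun j => ∫ z in cyl n (b ^ j) κ, h z)
      (E := fun j => ∫ z in halfSp n, h z * Φ (b ^ j) z)
      (X := fun j => ∫ z in shell n (b ^ j) ((b ^ j) ^ κ), h z * Φ (b ^ j) z)
      (δ := fun j => (b ^ j)⁻¹ + (b ^ j) ^ (-p)) hK hc0 (θ₁ := 1 / q) (θ₂ := p / q)
      (by positivity) ((div_lt_one hq0).2 hcrit) (by positivity) ((div_lt_one hq0).2 hpq)
      ?_ ?_ ?_ ?_ ?_ ?_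
    · have ht : Tendsto (fun j : ℕ => b ^ j) atTop atTop :=
        tendsto_pow_atTop_atTop_of_one_lt (by linarith)
      simpa using (tendsto_inv_atTop_zero.comp ht).add ((tendsto_rpow_neg_atTop hp).comp ht)
    · exact fun j => integral_nonneg (hw0 j)
    · intro j
      calc ∫ z in cyl n (b ^ j) κ, h z = ∫ z in cyl n (b ^ j) κ, h z * Φ (b ^ j) z :=
            setIntegral_congr_fun (hcyl_meas _) fun z hz => by
              simp only [(hΦ _ (hbj j)).2.2.1 z hz, mul_one]
        _ ≤ _ := setIntegral_mono_set (hΦ _ (hbj j)).2.2.2.1 (ae_of_all _ (hw0 j))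
          (hcyl_sub _).eventuallyLE
    · exact fun j => setIntegral_mono_set (hΦ _ (hbj j)).2.2.2.1 (ae_of_all _ (hw0 j))
        (hsub j).eventuallyLE
    · intro j
      have hshell : IntegrableOn h (shell n (b ^ j) ((b ^ j) ^ κ)) :=
        (hint _ _).mono_set sdiff_subset
      have h1 : ∫ z in shell n (b ^ j) ((b ^ j) ^ κ), h z * Φ (b ^ j) z ≤
          ∫ z in shell n (b ^ j) ((b ^ j) ^ κ), h z :=
        setIntegral_mono ((hΦ _ (hbj j)).2.2.2.1.mono_set (hsub j)) hshell fun z =>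
          mul_le_of_le_one_right (hh0 z) ((hΦ _ (hbj j)).2.1 z)
      have h2 : cyl n (b ^ j) κ ∪ shell n (b ^ j) ((b ^ j) ^ κ) ⊆ cyl n (b ^ (j + 1)) κ := by
        have e1 : 2 * b ^ j ≤ b ^ (j + 1) := by
          rw [pow_succ']
          exact mul_le_mul_of_nonneg_right hb2 (by positivity)
        have e2 : 2 * (b ^ j) ^ κ ≤ (b ^ (j + 1)) ^ κ := by
          rw [pow_succ', mul_rpow (by positivity) (by positivity)]
          exact mul_le_mul_of_nonneg_right hbκ (by positivity)
        have p1 : 0 < b ^ j := by positivity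
        have p2 : 0 < (b ^ j) ^ κ := by positivity
        refine union_subset (prod_mono (Metric.ball_subset_ball (by linarith))
          (Ioo_subset_Ioo_right (by linarith))) (sdiff_subset.trans
          (prod_mono (Metric.ball_subset_ball e1) (Ioo_subset_Ioo_right e2)))
      have h3 := setIntegral_mono_set
        (hint _ _ : IntegrableOn h (ball0 n (b ^ (j + 1)) ×ˢ Ioo 0 ((b ^ (j + 1)) ^ κ)))
        (ae_of_all _ hh0) h2.eventuallyLE
      have h4 : ∫ z in cyl n (b ^ j) κ ∪ shell n (b ^ j) ((b ^ j) ^ κ), h z =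
          (∫ z in cyl n (b ^ j) κ, h z) + ∫ z in shell n (b ^ j) ((b ^ j) ^ κ), h z :=
        setIntegral_union disjoint_sdiff_right (measurableSet_shell _ _ _) (hint _ _) hshell
      rw [h4] at h3
      exact (add_le_add le_rfl h1).trans h3
    · intro j Y hY hXY
      refine ((hΦ _ (hbj j)).2.2.2.2 Y hY hXY).trans (mul_le_mul_of_nonneg_left ?_ hK.le)
      have h1 := mul_le_mul_of_nonneg_right (hL j) hY.le
      have h2 := mul_nonneg (hL0 j) hY.le
      have h3 := rpow_le_rpow h2 h1 (by positivity : 0 ≤ 1 / q)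
      have h4 := rpow_le_rpow h2 h1 (by positivity : 0 ≤ p / q)
      linarith
  have hcover : halfSp n ⊆ ⋃ j : ℕ, cyl n (b ^ j) κ := by
    intro z hz
    have ht : Tendsto (fun j : ℕ => b ^ j) atTop atTop :=
      tendsto_pow_atTop_atTop_of_one_lt (by linarith)
    obtain ⟨j, hj1, hj2⟩ := ((ht.eventually_gt_atTop ‖z.1‖).and
      (((tendsto_rpow_atTop hκ0).comp ht).eventually_gt_atTop z.2)).exists
    exact mem_iUnion.2 ⟨j, by simpa [ball0] using hj1, hz, hj2⟩
  refine ae_restrict_of_ae_restrict_of_subset hcover ((ae_restrict_iUnion_iff _ _).2 fun j => ?_)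
  have hzero := (setIntegral_eq_zero_iff_of_nonneg_ae (ae_of_all _ hh0)
    (hint _ _ : IntegrableOn h (ball0 n (b ^ j) ×ˢ Ioo 0 ((b ^ j) ^ κ)))).1
    (le_antisymm (hFle j) (integral_nonneg hh0))
  filter_upwards [hzero] with z hz
  by_contra hne
  exact (hfpos _ (abs_pos.2 hne)).ne' hz
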